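/- Let n ≥ 2 be an integer and ξ a real number with ŵ_n(ξ) > 2n−2 (such ξ is necessarily not algebraic of degree at most n, so the best approximation sequence is defined). Then for all sufficiently large k, the best approximation polynomial P_k is irreducible over ℚ and has degree exactly n. -/

import Mathlib

open Polynomial Filter

noncomputable section

/-- Height of an integer polynomial: maximum absolute value of its coefficients. -/
def polyHeight (P : Polynomial ℤ) : ℕ :=
  P.support.sup fun i => (P.coeff i).natAbs

/-- The set of exponents `w` admissible for the uniform exponent `ŵ_n(ξ)`. -/
def uniformExpSet (n : ℕ) (ξ : ℝ) : Set ℝ :=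
  {w | ∀ᶠ X : ℝ in atTop, ∃ P : Polynomial ℤ, P.natDegree ≤ n ∧
    (polyHeight P : ℝ) ≤ X ∧ 0 < |Polynomial.aeval ξ P| ∧
    |Polynomial.aeval ξ P| < X ^ (-w)}

/-- The uniform exponent `ŵ_n(ξ)`, as an extended real. -/
def wHat (n : ℕ) (ξ : ℝ) : EReal :=
  sSup ((fun w : ℝ => (w : EReal)) '' uniformExpSet n ξ)

/-- The set of exponents `w` admissible for the ordinary exponent `w_n(ξ)`. -/
def ordExpSet (n : ℕ) (ξ : ℝ) : Set ℝ :=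
  {w | {P : Polynomial ℤ | P.natDegree ≤ n ∧ 0 < |Polynomial.aeval ξ P| ∧
      |Polynomial.aeval ξ P| < (polyHeight P : ℝ) ^ (-w)}.Infinite}

/-- The ordinary exponent `w_n(ξ)`, as an extended real. -/
def wOrd (n : ℕ) (ξ : ℝ) : EReal :=
  sSup ((fun w : ℝ => (w : EReal)) '' ordExpSet n ξ)

/-- `P` (1-indexed: the relevant values are `P 1, P 2, …`) is the sequence of best
approximation polynomials associated to `(n, ξ)`. -/
structure IsBestApproxSeq (n : ℕ) (ξ : ℝ) (P : ℕ → Polynomial ℤ) : Prop where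
  ne_zero : ∀ k, 1 ≤ k → P k ≠ 0
  deg_le : ∀ k, 1 ≤ k → (P k).natDegree ≤ n
  height_lt : ∀ k, 1 ≤ k → polyHeight (P k) < polyHeight (P (k+1))
  eval_lt : ∀ k, 1 ≤ k → |Polynomial.aeval ξ (P (k+1))| < |Polynomial.aeval ξ (P k)|
  isMin : ∀ k, 1 ≤ k → ∀ Q : Polynomial ℤ, Q ≠ 0 → Q.natDegree ≤ n →
    polyHeight Q ≤ polyHeight (P k) →
    |Polynomial.aeval ξ (P k)| ≤ |Polynomial.aeval ξ Q|
  complete : ∀ Q : Polynomial ℤ, Q ≠ 0 → Q.natDegree ≤ n →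
    (∀ R : Polynomial ℤ, R ≠ 0 → R.natDegree ≤ n → polyHeight R ≤ polyHeight Q →
      |Polynomial.aeval ξ Q| ≤ |Polynomial.aeval ξ R|) →
    ∃ k, 1 ≤ k ∧ (Q = P k ∨ Q = -P k)

/-- The image of an integer polynomial in `ℚ[X]`. -/
def ratPoly (P : Polynomial ℤ) : Polynomial ℚ := P.map (Int.castRingHom ℚ)

/-- `k` is good for the sequence `P`: `P_{k-1}, P_k, P_{k+1}` are `ℚ`-linearly independent. -/
def Good (P : ℕ → Polynomial ℤ) (k : ℕ) : Prop :=
  LinearIndependent ℚ ![ratPoly (P (k-1)), ratPoly (P k), ratPoly (P (k+1))]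

/-- `τ_k = log H_k / log H_{k-1}`. -/
def tauk (P : ℕ → Polynomial ℤ) (k : ℕ) : ℝ :=
  Real.log (polyHeight (P k)) / Real.log (polyHeight (P (k-1)))

/-- `μ_k = -log |P_{k-1}(ξ)| / log H_k`. -/
def muk (ξ : ℝ) (P : ℕ → Polynomial ℤ) (k : ℕ) : ℝ :=
  - Real.log |Polynomial.aeval ξ (P (k-1))| / Real.log (polyHeight (P k))

/-- `v_k = -log |P_k(ξ)| / log H_k`. -/
def vk (ξ : ℝ) (P : ℕ → Polynomial ℤ) (k : ℕ) : ℝ :=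
  - Real.log |Polynomial.aeval ξ (P k)| / Real.log (polyHeight (P k))

/-- The set of integers `m ≥ k+1` such that `P_{k-1}, …, P_{m-1}` all lie in the
two-dimensional space spanned by `P_{k-1}` and `P_k`; its greatest element is `ℓ(k)`. -/
def ellSet (P : ℕ → Polynomial ℤ) (k : ℕ) : Set ℕ :=
  {m | k + 1 ≤ m ∧ ∀ j, k - 1 ≤ j → j ≤ m - 1 →
    ratPoly (P j) ∈ Submodule.span ℚ {ratPoly (P (k-1)), ratPoly (P k)}}

/-- The set `V_k = {P, T·P, …, T^{n-2}·P}` (as rational polynomials). -/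
def Vset (n : ℕ) (A : Polynomial ℤ) : Set (Polynomial ℚ) :=
  {q | ∃ i ≤ n - 2, q = Polynomial.X ^ i * ratPoly A}

/-- The trajectory `L_P(q) = max(log H(P) - q/(2n-2), log |P(ξ)| + q)`. -/
def LPtraj (n : ℕ) (ξ : ℝ) (Q : Polynomial ℤ) (q : ℝ) : ℝ :=
  max (Real.log (polyHeight Q) - q / (2*(n:ℝ)-2)) (Real.log |Polynomial.aeval ξ Q| + q)

/-- The `j`-th successive minimum function `L_j(q)`: the infimum over sets of `j`
linearly independent integer polynomials of degree at most `2n-2` of the maximum of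
`L_P(q)` over the set. -/
def Lj (n : ℕ) (ξ : ℝ) (j : ℕ) (q : ℝ) : ℝ :=
  sInf {y : ℝ | ∃ S : Finset (Polynomial ℤ), S.card = j ∧
    (∀ Q ∈ S, Q.natDegree ≤ 2*n-2) ∧
    LinearIndependent ℚ (fun Q : {x // x ∈ S} => ratPoly (Q : Polynomial ℤ)) ∧
    y = sSup ((fun Q => LPtraj n ξ Q q) '' (S : Set (Polynomial ℤ)))}

theorem abs_coeff_le_polyHeight (Q : ℤ[X]) (i : ℕ) : |(Q.coeff i : ℝ)| ≤ polyHeight Q := by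
  by_cases h : i ∈ Q.support
  · have := Finset.le_sup (f := fun i => (Q.coeff i).natAbs) h
    rw [← Int.cast_abs, Int.abs_eq_natAbs]
    exact_mod_cast this
  · simp [notMem_support_iff.mp h]

/-- The Mahler measure of an integer polynomial. -/
def intMahler (Q : ℤ[X]) : ℝ := (Q.map (Int.castRingHom ℂ)).mahlerMeasure

theorem intMahler_mul (Q R : ℤ[X]) : intMahler (Q * R) = intMahler Q * intMahler R := by
  simp [intMahler, mahlerMeasure_mul]

theorem one_le_intMahler {Q : ℤ[X]} (hQ : Q ≠ 0) : 1 ≤ intMahler Q :=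
  one_le_mahlerMeasure_of_ne_zero hQ

theorem intMahler_nonneg (Q : ℤ[X]) : 0 ≤ intMahler Q := mahlerMeasure_nonneg _

theorem intMahler_le_mul_polyHeight {n : ℕ} {Q : ℤ[X]} (hQ : Q.natDegree ≤ n) :
    intMahler Q ≤ (n + 1) * polyHeight Q := by
  refine (mahlerMeasure_le_sum_norm_coeff _).trans ?_
  rw [sum_over_range' _ (fun _ => norm_zero) (n + 1)
    ((natDegree_map_le).trans_lt (Nat.lt_succ_of_le hQ))]
  refine (Finset.sum_le_card_nsmul _ _ (polyHeight Q : ℝ) fun i _ => ?_).trans (by simp)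
  simpa using abs_coeff_le_polyHeight Q i

theorem abs_coeff_le_mul_intMahler {n : ℕ} {Q : ℤ[X]} (hQ : Q.natDegree ≤ n) (i : ℕ) :
    |(Q.coeff i : ℝ)| ≤ 2 ^ n * intMahler Q := by
  have h := norm_coeff_le_choose_mul_mahlerMeasure i (Q.map (Int.castRingHom ℂ))
  simp only [coeff_map, eq_intCast, Complex.norm_intCast] at h
  refine h.trans (mul_le_mul_of_nonneg_right ?_ (intMahler_nonneg Q))
  calc ((Nat.choose _ i : ℕ) : ℝ) ≤ 2 ^ (Q.map (Int.castRingHom ℂ)).natDegree := by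
        exact_mod_cast Nat.choose_le_two_pow _ _
    _ ≤ 2 ^ n := pow_le_pow_right₀ one_le_two (natDegree_map_le.trans hQ)

/-- If all entries of a square matrix are bounded by `B`, and a linear combination of its rows in
which row `r` has coefficient one has entries bounded by `δ`, then the determinant is small. -/
theorem abs_det_le_of_row_combination {N : ℕ} (A : Matrix (Fin N) (Fin N) ℝ) (r : Fin N)
    (v : Fin N → ℝ) (hv : v r = 1) {B δ : ℝ} (hA : ∀ i j, |A i j| ≤ B)
    (hδ : ∀ j, |∑ i, v i * A i j| ≤ δ) :
    |A.det| ≤ N.factorial * (B ^ (N - 1) * δ) := by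
  have hdet := Matrix.det_updateRow_sum A r v
  rw [hv, one_smul] at hdet
  rw [← hdet, ← Matrix.det_transpose, Matrix.det_apply]
  refine (Finset.abs_sum_le_sum_abs _ _).trans ?_
  refine (Finset.sum_le_card_nsmul _ _ (B ^ (N - 1) * δ) fun σ _ => ?_).trans ?_
  · rw [Units.smul_def, zsmul_eq_mul, abs_mul, ← Int.cast_abs, Int.isUnit_iff_abs_eq.mp (Units.isUnit _), Int.cast_one,
      one_mul, Finset.abs_prod, ← Finset.mul_prod_erase _ _ (Finset.mem_univ r), mul_comm]
    have hB : 0 ≤ B := (abs_nonneg _).trans (hA r r)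
    refine mul_le_mul ?_ ?_ (abs_nonneg _) (pow_nonneg hB _)
    · refine (Finset.prod_le_prod (fun _ _ => abs_nonneg _) (g := fun _ => B) ?_).trans ?_
      · intro i hi
        rw [Matrix.transpose_apply, Matrix.updateRow_ne (Finset.ne_of_mem_erase hi)]
        exact hA _ _
      · simp
    · simpa [Matrix.updateRow_self, Finset.sum_apply] using hδ (σ r)
  · simp [Finset.card_univ, Fintype.card_perm]

theorem sum_pow_mul_shifted_coeff (g : ℝ[X]) (ξ : ℝ) {m n j : ℕ} (hj : j < m)
    (hg : g.natDegree ≤ n) :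
    ∑ i : Fin (m + n), ξ ^ (i : ℕ) *
      (if (i : ℕ) ∈ Set.Icc j (j + n) then g.coeff (i - j) else 0) = ξ ^ j * g.eval ξ := by
  rw [Fin.sum_univ_eq_sum_range
    (fun i => ξ ^ i * (if i ∈ Set.Icc j (j + n) then g.coeff (i - j) else 0)),
    eval_eq_sum_range' (Nat.lt_succ_of_le hg), Finset.mul_sum]
  symm
  have hsub : (Finset.range (n + 1)).map (addLeftEmbedding j) ⊆ Finset.range (m + n) := by
    intro i hi
    simp only [Finset.mem_map, Finset.mem_range, addLeftEmbedding_apply] at hi ⊢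
    omega
  rw [← Finset.sum_subset hsub, Finset.sum_map]
  · refine Finset.sum_congr rfl fun i hi => ?_
    have : j + i ∈ Set.Icc j (j + n) := by
      simp only [Finset.mem_range, Set.mem_Icc] at hi ⊢
      omega
    simp only [addLeftEmbedding_apply, if_pos this, Nat.add_sub_cancel_left, pow_add]
    ring
  · intro i _ hi
    rw [if_neg, mul_zero]
    rintro ⟨h₁, h₂⟩
    refine hi (Finset.mem_map.mpr ⟨i - j, ?_, ?_⟩)
    · simp only [Finset.mem_range]; omega
    · simp only [addLeftEmbedding_apply]; omega

/-- The resultant of two polynomials is small when both are small at a common point. -/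
theorem abs_resultant_le (f g : ℝ[X]) (ξ : ℝ) {B δ : ℝ} (hB : 0 ≤ B)
    (hpos : 0 < f.natDegree + g.natDegree)
    (hf : ∀ i, |f.coeff i| ≤ B) (hg : ∀ i, |g.coeff i| ≤ B)
    (hfξ : |f.eval ξ| ≤ δ) (hgξ : |g.eval ξ| ≤ δ) :
    |resultant f g| ≤ (f.natDegree + g.natDegree).factorial *
      (B ^ (f.natDegree + g.natDegree - 1) *
        (max 1 |ξ| ^ (f.natDegree + g.natDegree) * δ)) := by
  have key : ∀ (h : ℝ[X]) (j : ℕ), j ≤ f.natDegree + g.natDegree → |h.eval ξ| ≤ δ →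
      |ξ ^ j * h.eval ξ| ≤ max 1 |ξ| ^ (f.natDegree + g.natDegree) * δ := by
    intro h j hj hδ
    rw [abs_mul, abs_pow]
    refine mul_le_mul ?_ hδ (abs_nonneg _) (by positivity)
    exact (pow_le_pow_left₀ (abs_nonneg _) (le_max_right _ _) _).trans
      (pow_le_pow_right₀ (le_max_left _ _) hj)
  refine abs_det_le_of_row_combination _ ⟨0, hpos⟩ (fun i => ξ ^ (i : ℕ)) (by simp) ?_ ?_
  · intro i j
    induction j using Fin.addCases <;>
    · simp only [sylvester, Matrix.of_apply, Fin.addCases_left, Fin.addCases_right]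
      split_ifs
      · first | exact hg _ | exact hf _
      · simpa using hB
  · intro j
    induction j using Fin.addCases with
    | left j =>
      simp only [sylvester, Matrix.of_apply, Fin.addCases_left]
      rw [sum_pow_mul_shifted_coeff g ξ j.2 le_rfl]
      exact key g j (by omega) hgξ
    | right j =>
      simp only [sylvester, Matrix.of_apply, Fin.addCases_right]
      have h := sum_pow_mul_shifted_coeff f ξ j.2 le_rfl
      rw [Fin.sum_univ_eq_sum_range (fun i => ξ ^ i *
        (if i ∈ Set.Icc (j : ℕ) (j + f.natDegree) then f.coeff (i - j) else 0))] at h ⊢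
      rw [add_comm f.natDegree g.natDegree, h, add_comm g.natDegree]
      exact key f j (by omega) hfξ

/-- An irreducible nonconstant integer polynomial not dividing `R` has nonzero resultant
with `R`. -/
theorem one_le_abs_resultant {Q R : ℤ[X]} (hQ : Irreducible Q) (hdeg : Q.natDegree ≠ 0)
    (hQR : ¬ Q ∣ R) :
    1 ≤ |resultant (Q.map (Int.castRingHom ℝ)) (R.map (Int.castRingHom ℝ))| := by
  have hprim := hQ.isPrimitive hdeg
  have hcop : IsCoprime (Q.map (Int.castRingHom ℚ)) (R.map (Int.castRingHom ℚ)) :=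
    ((IsPrimitive.Int.irreducible_iff_irreducible_map_cast hprim).mp hQ).coprime_iff_not_dvd.mpr
      fun h => hQR ((IsPrimitive.Int.dvd_iff_map_cast_dvd_map_cast Q R hprim).mpr h)
  have hne := resultant_ne_zero _ _ hcop
  rw [natDegree_map_eq_of_injective (Int.castRingHom ℚ).injective_int,
    natDegree_map_eq_of_injective (Int.castRingHom ℚ).injective_int, resultant_map_map] at hne
  rw [natDegree_map_eq_of_injective (Int.castRingHom ℝ).injective_int,
    natDegree_map_eq_of_injective (Int.castRingHom ℝ).injective_int, resultant_map_map,
    eq_intCast, ← Int.cast_abs]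
  exact_mod_cast Int.one_le_abs fun h => hne (by simp [h])

/-- The multiplicative weight `|Q(ξ)| M(Q)^w`. -/
def mahlerWeight (ξ w : ℝ) (Q : ℤ[X]) : ℝ := |aeval ξ Q| * intMahler Q ^ w

theorem mahlerWeight_mul (ξ w : ℝ) (Q R : ℤ[X]) :
    mahlerWeight ξ w (Q * R) = mahlerWeight ξ w Q * mahlerWeight ξ w R := by
  rw [mahlerWeight, mahlerWeight, mahlerWeight, map_mul, abs_mul, intMahler_mul,
    Real.mul_rpow (intMahler_nonneg Q) (intMahler_nonneg R)]
  ring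

theorem mahlerWeight_nonneg (ξ w : ℝ) (Q : ℤ[X]) : 0 ≤ mahlerWeight ξ w Q :=
  mul_nonneg (abs_nonneg _) (Real.rpow_nonneg (intMahler_nonneg Q) _)

theorem one_le_mahlerWeight_of_natDegree_eq_zero (ξ : ℝ) {w : ℝ} (hw : 0 ≤ w) {Q : ℤ[X]}
    (hQ : Q ≠ 0) (hdeg : Q.natDegree = 0) : 1 ≤ mahlerWeight ξ w Q := by
  refine one_le_mul_of_one_le_of_one_le ?_ (Real.one_le_rpow (one_le_intMahler hQ) hw)
  obtain ⟨c, rfl⟩ := natDegree_eq_zero.mp hdeg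
  have hc : c ≠ 0 := fun h => hQ (by simp [h])
  rw [aeval_C, algebraMap_int_eq, eq_intCast, ← Int.cast_abs]
  exact_mod_cast Int.one_le_abs hc

theorem pow_natDegree_le_mahlerWeight (ξ : ℝ) {w ε : ℝ} (hw : 0 ≤ w) (hε : 0 ≤ ε) (A : ℤ[X])
    (hA : A ≠ 0)
    (h : ∀ Q : ℤ[X], Irreducible Q → Q ∣ A → ε ^ Q.natDegree ≤ mahlerWeight ξ w Q) :
    ε ^ A.natDegree ≤ mahlerWeight ξ w A := by
  induction A using WfDvdMonoid.induction_on_irreducible with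
  | zero => exact absurd rfl hA
  | unit u hu =>
    rw [natDegree_eq_zero_of_isUnit hu, pow_zero]
    exact one_le_mahlerWeight_of_natDegree_eq_zero ξ hw hA (natDegree_eq_zero_of_isUnit hu)
  | mul a i ha hi ih =>
    rw [natDegree_mul hi.ne_zero ha, pow_add, mahlerWeight_mul]
    exact mul_le_mul (h i hi (dvd_mul_right _ _))
      (ih ha fun Q hQ hd => h Q hQ (hd.mul_left i)) (by positivity) (mahlerWeight_nonneg _ _ _)

/-- Uniform approximability beyond `2n-2` forces irreducible polynomials of degree
less than `n` and large Mahler measure to be not too small at `ξ`. -/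
theorem eventually_one_lt_mahlerWeight {n : ℕ} (hn : 2 ≤ n) {ξ w v : ℝ}
    (hw : w ∈ uniformExpSet n ξ) (hv : 2 * (n : ℝ) - 2 < v) (hvw : v < w) :
    ∀ᶠ M : ℝ in atTop, ∀ Q : ℤ[X], Irreducible Q → Q.natDegree ≠ 0 → Q.natDegree < n →
      intMahler Q = M → 1 < mahlerWeight ξ v Q := by
  have hn' : (0 : ℝ) < 2 * (n + 1) := by positivity
  set K : ℝ := (2 * n - 1).factorial * ((2 ^ n) ^ (2 * n - 2) * max 1 |ξ| ^ (2 * n - 1)) with hK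
  have hR : ∀ᶠ M : ℝ in atTop, ∃ R : ℤ[X], R.natDegree ≤ n ∧
      (polyHeight R : ℝ) ≤ M / (2 * (n + 1)) ∧ 0 < |aeval ξ R| ∧
      |aeval ξ R| < (M / (2 * (n + 1))) ^ (-w) :=
    (tendsto_id.atTop_div_const hn').eventually hw
  have hlim₁ : Tendsto (fun M : ℝ => (2 * ((n : ℝ) + 1)) ^ w * M ^ (-(w - v))) atTop (nhds 0) := by
    simpa using (tendsto_rpow_neg_atTop (sub_pos.mpr hvw)).const_mul ((2 * ((n : ℝ) + 1)) ^ w)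
  have hlim₂ : Tendsto (fun M : ℝ => K * M ^ (-(v - (2 * (n : ℝ) - 2)))) atTop (nhds 0) := by
    simpa using (tendsto_rpow_neg_atTop (sub_pos.mpr hv)).const_mul K
  filter_upwards [hR, hlim₁.eventually_lt_const one_pos, hlim₂.eventually_lt_const one_pos,
    eventually_ge_atTop 1] with M ⟨R, hRdeg, hRH, hRpos, hRξ⟩ h₁ h₂ hM Q hQ hQ0 hQn hQM
  by_contra! hcon
  have hM0 : 0 < M := one_pos.trans_le hM
  have hR0 : R ≠ 0 := fun h => by simp [h] at hRpos
  have hQR : ¬ Q ∣ R := by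
    rintro ⟨S, rfl⟩
    have hle := intMahler_le_mul_polyHeight hRdeg
    have hS := one_le_intMahler (right_ne_zero_of_mul hR0)
    rw [intMahler_mul, hQM] at hle
    rw [le_div_iff₀ hn'] at hRH
    nlinarith
  have hQξ : |aeval ξ Q| ≤ M ^ (-v) := by
    rw [mahlerWeight, hQM] at hcon
    rw [Real.rpow_neg hM0.le, ← one_div, le_div_iff₀ (Real.rpow_pos_of_pos hM0 v)]
    exact hcon
  have hRξ' : |aeval ξ R| ≤ M ^ (-v) := by
    refine hRξ.le.trans ?_
    have hsplit : (M / (2 * ((n : ℝ) + 1))) ^ (-w) =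
        ((2 * ((n : ℝ) + 1)) ^ w * M ^ (-(w - v))) * M ^ (-v) := by
      rw [mul_assoc, ← Real.rpow_add hM0, Real.div_rpow hM0.le hn'.le, Real.rpow_neg hn'.le w,
        div_inv_eq_mul, mul_comm]
      congr 2
      ring
    rw [hsplit]
    exact mul_le_of_le_one_left (Real.rpow_nonneg hM0.le _) h₁.le
  have h2n : (1 : ℝ) ≤ 2 ^ n := one_le_pow₀ one_le_two
  have hB : 1 ≤ 2 ^ n * M := one_le_mul_of_one_le_of_one_le h2n hM
  have hdQ := natDegree_map_eq_of_injective (Int.castRingHom ℝ).injective_int Q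
  have hdR := natDegree_map_eq_of_injective (Int.castRingHom ℝ).injective_int R
  have hres := abs_resultant_le (Q.map (Int.castRingHom ℝ)) (R.map (Int.castRingHom ℝ)) ξ
    (B := 2 ^ n * M) (δ := M ^ (-v)) (by positivity) (by omega)
    (fun i => by
      simpa [hQM] using abs_coeff_le_mul_intMahler hQn.le i)
    (fun i => by
      rw [coeff_map, eq_intCast]
      refine (abs_coeff_le_polyHeight R i).trans (hRH.trans ?_)
      refine (div_le_self hM0.le (by linarith [(Nat.cast_nonneg n : (0 : ℝ) ≤ n)])).trans ?_
      exact le_mul_of_one_le_left hM0.le h2n)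
    (by simpa [aeval_def, eval_map] using hQξ) (by simpa [aeval_def, eval_map] using hRξ')
  rw [hdQ, hdR] at hres
  have hge := one_le_abs_resultant hQ hQ0 hQR
  rw [hdQ, hdR] at hge
  refine (hge.trans hres).not_gt (lt_of_le_of_lt ?_ h₂)
  have hN : Q.natDegree + R.natDegree ≤ 2 * n - 1 := by omega
  have hN' : Q.natDegree + R.natDegree - 1 ≤ 2 * n - 2 := by omega
  calc _ ≤ ((2 * n - 1).factorial : ℝ) * ((2 ^ n * M) ^ (2 * n - 2) *
          (max 1 |ξ| ^ (2 * n - 1) * M ^ (-v))) := by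
        gcongr
        · exact le_max_left _ _
    _ = K * M ^ (-(v - (2 * (n : ℝ) - 2))) := by
        have hpow : M ^ (-(v - (2 * (n : ℝ) - 2))) = M ^ (2 * n - 2) * M ^ (-v) := by
          rw [← Real.rpow_natCast M, ← Real.rpow_add hM0, Nat.cast_sub (by omega)]
          congr 1
          push_cast
          ring
        rw [hpow, hK, mul_pow]
        ring

theorem exists_pos_le_mahlerWeight {n : ℕ} (hn : 2 ≤ n) {ξ w v : ℝ}
    (hξ : ∀ Q : ℤ[X], Q ≠ 0 → Q.natDegree ≤ n → aeval ξ Q ≠ 0)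
    (hw : w ∈ uniformExpSet n ξ) (hv : 2 * (n : ℝ) - 2 < v) (hvw : v < w) :
    ∃ ε : ℝ, 0 < ε ∧ ε ≤ 1 ∧ ∀ Q : ℤ[X], Irreducible Q → Q.natDegree ≠ 0 →
      Q.natDegree < n → ε ≤ mahlerWeight ξ v Q := by
  obtain ⟨B, hB⟩ := eventually_atTop.mp (eventually_one_lt_mahlerWeight hn hw hv hvw)
  have hfin : {Q : ℤ[X] | Q ≠ 0 ∧ Q.natDegree ≤ n ∧ intMahler Q ≤ B}.Finite :=
    (finite_mahlerMeasure_le n B.toNNReal).subset fun Q hQ =>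
      ⟨hQ.2.1, hQ.2.2.trans (Real.le_coe_toNNReal B)⟩
  obtain ⟨ε, hε, hεmin⟩ : ∃ ε : ℝ, 0 < ε ∧
      ∀ Q ∈ {Q : ℤ[X] | Q ≠ 0 ∧ Q.natDegree ≤ n ∧ intMahler Q ≤ B},
        ε ≤ mahlerWeight ξ v Q := by
    have hall : ∀ Q ∈ {Q : ℤ[X] | Q ≠ 0 ∧ Q.natDegree ≤ n ∧ intMahler Q ≤ B},
        ∀ᶠ ε : ℝ in nhdsWithin 0 (Set.Ioi 0), ε ≤ mahlerWeight ξ v Q := fun Q hQ =>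
      nhdsWithin_le_nhds (eventually_le_nhds (mul_pos (abs_pos.mpr (hξ Q hQ.1 hQ.2.1))
        (Real.rpow_pos_of_pos (one_pos.trans_le (one_le_intMahler hQ.1)) _)))
    obtain ⟨ε, h₁, h₂⟩ :=
      (((eventually_all_finite hfin).mpr hall).and self_mem_nhdsWithin).exists
    exact ⟨ε, h₂, h₁⟩
  refine ⟨min ε 1, lt_min hε one_pos, min_le_right _ _, fun Q hQ hQ0 hQn => ?_⟩
  rcases le_total (intMahler Q) B with h | h
  · exact (min_le_left _ _).trans (hεmin Q ⟨hQ.ne_zero, hQn.le, h⟩)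
  · exact (min_le_right _ _).trans (hB _ h Q hQ hQ0 hQn rfl).le

theorem IsBestApproxSeq.tendsto_polyHeight {n : ℕ} {ξ : ℝ} {P : ℕ → ℤ[X]}
    (hP : IsBestApproxSeq n ξ P) : Tendsto (fun k => polyHeight (P k)) atTop atTop := by
  rw [← tendsto_add_atTop_iff_nat 1]
  exact (strictMono_nat_of_lt_succ fun k => hP.height_lt (k + 1) (by omega)).tendsto_atTop

theorem IsBestApproxSeq.aeval_ne_zero {n : ℕ} {ξ : ℝ} {P : ℕ → ℤ[X]}
    (hP : IsBestApproxSeq n ξ P) (Q : ℤ[X]) (hQ : Q ≠ 0) (hdeg : Q.natDegree ≤ n) :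
    aeval ξ Q ≠ 0 := by
  intro h
  obtain ⟨k, hk, hk1⟩ := ((hP.tendsto_polyHeight.eventually_ge_atTop (polyHeight Q)).and
    (eventually_ge_atTop 1)).exists
  have h₁ := hP.isMin k hk1 Q hQ hdeg hk
  have h₂ := hP.eval_lt k hk1
  rw [h, abs_zero] at h₁
  exact (abs_nonneg _).not_gt (h₂.trans_le h₁)

/-- The weights of the best approximation polynomials tend to zero for every exponent below an
admissible uniform exponent. -/
theorem IsBestApproxSeq.eventually_mahlerWeight_lt {n : ℕ} {ξ : ℝ} {P : ℕ → ℤ[X]}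
    (hP : IsBestApproxSeq n ξ P) {w v c : ℝ} (hw : w ∈ uniformExpSet n ξ) (hv : 0 ≤ v)
    (hvw : v < w) (hc : 0 < c) : ∀ᶠ k in atTop, mahlerWeight ξ v (P k) < c := by
  have hH : Tendsto (fun k => (polyHeight (P k) : ℝ)) atTop atTop :=
    tendsto_natCast_atTop_atTop.comp hP.tendsto_polyHeight
  have hlim : Tendsto (fun X : ℝ => ((n : ℝ) + 1) ^ v * X ^ (-(w - v))) atTop (nhds 0) := by
    simpa using (tendsto_rpow_neg_atTop (sub_pos.mpr hvw)).const_mul (((n : ℝ) + 1) ^ v)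
  filter_upwards [hH.eventually hw, hH.eventually (hlim.eventually_lt_const hc),
    hH.eventually_gt_atTop 0, eventually_ge_atTop 1] with k ⟨R, hRdeg, hRH, hRpos, hRξ⟩ hk hk0 hk1
  have hR0 : R ≠ 0 := fun h => by simp [h] at hRpos
  have hPξ := (hP.isMin k hk1 R hR0 hRdeg (by exact_mod_cast hRH)).trans hRξ.le
  refine lt_of_le_of_lt ?_ hk
  calc mahlerWeight ξ v (P k)
      ≤ (polyHeight (P k) : ℝ) ^ (-w) * ((n + 1) * (polyHeight (P k) : ℝ)) ^ v :=
        mul_le_mul hPξ (Real.rpow_le_rpow (intMahler_nonneg _)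
          (intMahler_le_mul_polyHeight (hP.deg_le k hk1)) hv)
          (Real.rpow_nonneg (intMahler_nonneg _) _) (Real.rpow_nonneg hk0.le _)
    _ = ((n : ℝ) + 1) ^ v * (polyHeight (P k) : ℝ) ^ (-(w - v)) := by
        rw [Real.mul_rpow (by positivity) hk0.le, mul_left_comm, ← Real.rpow_add hk0]
        congr 2
        ring

/-- An integer polynomial with an irreducible divisor of the same positive degree is irreducible
over `ℚ`. -/
theorem irreducible_ratPoly_of_dvd {A Q : ℤ[X]} (hA : A ≠ 0) (hQ : Irreducible Q)
    (hQ0 : Q.natDegree ≠ 0) (hdvd : Q ∣ A) (hdeg : A.natDegree = Q.natDegree) :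
    Irreducible (ratPoly A) := by
  obtain ⟨S, rfl⟩ := hdvd
  have hS := right_ne_zero_of_mul hA
  rw [natDegree_mul hQ.ne_zero hS] at hdeg
  obtain ⟨c, rfl⟩ := natDegree_eq_zero.mp (show S.natDegree = 0 by omega)
  have hc : IsUnit (C (c : ℚ)) := isUnit_C.mpr (isUnit_iff_ne_zero.mpr fun h => hS (by
    rw [Int.cast_eq_zero.mp h, C_0]))
  have hirr := (IsPrimitive.Int.irreducible_iff_irreducible_map_cast
    (hQ.isPrimitive hQ0)).mp hQ
  rw [ratPoly, Polynomial.map_mul, map_C, eq_intCast, irreducible_mul_isUnit hc]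
  exact hirr

/-- if `ŵ_n(ξ) > 2n-2`, then for all sufficiently large `k` the best
approximation polynomial `P_k` is irreducible over `ℚ` of degree exactly `n`. -/
theorem stmt3 (n : ℕ) (hn : 2 ≤ n) (ξ : ℝ)
    (P : ℕ → Polynomial ℤ) (hP : IsBestApproxSeq n ξ P)
    (hw : ((2*(n:ℝ)-2 : ℝ) : EReal) < wHat n ξ) :
    ∀ᶠ k in Filter.atTop, (P k).natDegree = n ∧ Irreducible (ratPoly (P k)) := by
  obtain ⟨_, ⟨w, hw', rfl⟩, hlt⟩ := lt_sSup_iff.mp hw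
  have hlt' : 2 * (n : ℝ) - 2 < w := EReal.coe_lt_coe_iff.mp hlt
  obtain ⟨v, hv, hvw⟩ := exists_between hlt'
  have hn' : (2 : ℝ) ≤ n := by exact_mod_cast hn
  have hv0 : 0 ≤ v := by linarith
  obtain ⟨ε, hε, hε1, hmin⟩ := exists_pos_le_mahlerWeight hn hP.aeval_ne_zero hw' hv hvw
  filter_upwards [hP.eventually_mahlerWeight_lt hw' hv0 hvw (pow_pos hε n),
    eventually_ge_atTop 1] with k hk hk1
  have hA := hP.ne_zero k hk1
  have hdeg := hP.deg_le k hk1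
  obtain ⟨Q, hQ, hdvd, hQn⟩ : ∃ Q : ℤ[X], Irreducible Q ∧ Q ∣ P k ∧ n ≤ Q.natDegree := by
    by_contra! hcon
    refine (pow_natDegree_le_mahlerWeight ξ hv0 hε.le (P k) hA fun Q hQ hdvd => ?_).not_gt
      (hk.trans_le (pow_le_pow_of_le_one hε.le hε1 hdeg))
    by_cases hQ0 : Q.natDegree = 0
    · rw [hQ0, pow_zero]
      exact one_le_mahlerWeight_of_natDegree_eq_zero ξ hv0 hQ.ne_zero hQ0
    · exact (pow_le_of_le_one hε.le hε1 hQ0).trans (hmin Q hQ hQ0 (hcon Q hQ hdvd))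
  have hle := natDegree_le_of_dvd hdvd hA
  exact ⟨by omega, irreducible_ratPoly_of_dvd hA hQ (by omega) hdvd (by omega)⟩
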